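/- arXiv:hep-th/0408055 — 2 statements merged into one kernel-verified Lean document; each statement's English description precedes it below -/
import Mathlib

section
/- Let s > 0 be real and define F_s : ℝ → ℝ by F_s(x) = ∫_0^∞ t^(s-1) / (e^(t-x) + 1) dt. Then there exist constants C > 0 and X > 0 such that for all x ≥ X: |F_s(x) - x^s / s - (π²/6) (s-1) x^(s-2)| ≤ C · x^(s-4). -/
open Real MeasureTheory Set Filter Topology

noncomputable def kap (u : ℝ) : ℝ := exp u / (exp u + 1)^2

lemma kap_pos (u : ℝ) : 0 < kap u := by unfold kap; positivity

lemma kap_cont : Continuous kap := by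
  unfold kap
  exact continuous_exp.div (by fun_prop) (fun u => by positivity)

lemma kap_neg (u : ℝ) : kap (-u) = kap u := by
  unfold kap
  rw [exp_neg]
  have := exp_pos u
  field_simp
  ring

lemma kap_abs (u : ℝ) : kap |u| = kap u := by
  rcases abs_choice u with h | h <;> rw [h]
  exact kap_neg u

lemma kap_le_exp_neg (u : ℝ) : kap u ≤ exp (-u) := by
  unfold kap
  rw [exp_neg]
  have := exp_pos u
  rw [div_le_iff₀ (by positivity), inv_mul_eq_div, le_div_iff₀ this]
  nlinarith

lemma rpow_kap_integrableOn (a : ℝ) (ha : 0 ≤ a) :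
    IntegrableOn (fun u => |u| ^ a * kap u) (Ioi 0) := by
  have h := GammaIntegral_convergent (s := a + 1) (by linarith)
  refine Integrable.mono' h ?_ ?_
  · exact ((continuous_abs.rpow_const (fun _ => Or.inr ha)).mul kap_cont).aestronglyMeasurable
  · refine (ae_restrict_iff' measurableSet_Ioi).2 (Eventually.of_forall fun u hu => ?_)
    have hu : 0 < u := hu
    rw [norm_of_nonneg (mul_nonneg (by positivity) (kap_pos u).le), abs_of_pos hu, add_sub_cancel_right, mul_comm]
    exact mul_le_mul_of_nonneg_right (kap_le_exp_neg u) (by positivity)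

lemma rpow_kap_integrable (a : ℝ) (ha : 0 ≤ a) :
    Integrable (fun u => |u| ^ a * kap u) := by
  have h := rpow_kap_integrableOn a ha
  rw [← integrableOn_univ, ← Iic_union_Ioi (a := (0:ℝ))]
  refine IntegrableOn.union ?_ h
  rw [← Measure.map_neg_eq_self (volume : Measure ℝ)]
  let m : MeasurableEmbedding fun x : ℝ => -x := (Homeomorph.neg ℝ).measurableEmbedding
  rw [m.integrableOn_map_iff]
  simp_rw [Function.comp_def, abs_neg, kap_neg, neg_preimage, neg_Iic, neg_zero]
  exact Iff.mpr integrableOn_Ici_iff_integrableOn_Ioi h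

lemma pow_kap_integrable (n : ℕ) : Integrable (fun u => u ^ n * kap u) := by
  refine (rpow_kap_integrable n (by positivity)).mono' (by
    exact ((continuous_pow n).mul kap_cont).aestronglyMeasurable) (Eventually.of_forall fun u => ?_)
  rw [norm_mul, norm_pow, rpow_natCast, norm_of_nonneg (kap_pos u).le, norm_eq_abs]

lemma odd_kap (n : ℕ) (hn : Odd n) : ∫ u, u ^ n * kap u = 0 := by
  have := integral_neg_eq_self (fun u : ℝ => u ^ n * kap u) volume
  simp only [hn.neg_pow, kap_neg, neg_mul, integral_neg] at this
  linarith

lemma int_kap : ∫ u, kap u = 1 := by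
  have h1 : ∀ x : ℝ, HasDerivAt (fun u => -(exp u + 1)⁻¹) (kap x) x := by
    intro x
    have := (((hasDerivAt_exp x).add_const 1).inv (by positivity)).neg
    convert! this using 1
    unfold kap; ring
  have h0 := pow_kap_integrable 0
  simp only [pow_zero, one_mul] at h0
  have := integral_of_hasDerivAt_of_tendsto (f := fun u => -(exp u + 1)⁻¹) (f' := kap) (m := -1) (n := 0) h1 h0 ?_ ?_
  · rw [this]; norm_num
  · have := ((tendsto_exp_atBot.add_const 1).inv₀ (by norm_num)).neg
    simpa using this
  · have := ((tendsto_atTop_add_const_right _ (1:ℝ) tendsto_exp_atTop).inv_tendsto_atTop).neg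
    simpa using this

lemma eta_two : HasSum (fun n : ℕ => (-1:ℝ)^(n+1) / (n:ℝ)^2) (π^2/12) := by
  have hz := hasSum_zeta_two
  have he : HasSum (fun n : ℕ => if Even n then (1:ℝ)/(n:ℝ)^2 else 0) (π^2/24) := by
    have h4 : HasSum (fun n : ℕ => (1:ℝ)/((2*n : ℕ):ℝ)^2) (π^2/24) := by
      convert! hz.mul_left (1/4) using 1
      · ext n; push_cast; ring
      · ring
    have hinj : Function.Injective (fun n : ℕ => 2 * n) := fun a b h => by simpa using h
    rw [← hinj.hasSum_iff]
    · convert! h4 using 1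
      ext n; simp
    · intro n hn
      rw [if_neg]
      rintro ⟨k, hk⟩
      exact hn ⟨k, by simp; omega⟩
  convert! hz.sub (he.mul_left 2) using 1
  · ext n
    split_ifs with h
    · rw [(h.add_one).neg_one_pow]; ring
    · rw [((Nat.not_even_iff_odd.1 h).add_one).neg_one_pow]; ring
  · ring

lemma int_sq_kap_Ioi : ∫ u in Ioi (0:ℝ), u^2 * kap u = π^2/6 := by
  have hint : ∀ n : ℕ, 0 < n → IntegrableOn (fun u : ℝ => u^2 * exp (-(n*u))) (Ioi 0) := by
    intro n hn
    have := integrableOn_rpow_mul_exp_neg_mul_rpow (p := 1) (s := 2) (b := n) (by norm_num) (by norm_num) (by positivity)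
    simpa using this
  have hval : ∀ n : ℕ, 0 < n → ∫ u in Ioi (0:ℝ), u^2 * exp (-(n*u)) = 2 / (n:ℝ)^3 := by
    intro n hn
    have := integral_rpow_mul_exp_neg_mul_Ioi (a := 3) (r := n) (by norm_num) (by positivity)
    have hG : Gamma 3 = 2 := by
      rw [show (3:ℝ) = (2:ℕ) + 1 by norm_num, Gamma_nat_eq_factorial]; norm_num
    rw [hG] at this
    norm_num at this
    rw [this]; field_simp
  let F : ℕ → ℝ → ℝ := fun n u => (-1)^(n+1) * n * (u^2 * exp (-(n*u)))
  have hF1 : ∀ n, Integrable (F n) (volume.restrict (Ioi 0)) := by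
    intro n
    rcases Nat.eq_zero_or_pos n with rfl | hn
    · simp [F]
    · exact (hint n hn).const_mul _
  have hnorm : ∀ n, ∫ u in Ioi (0:ℝ), ‖F n u‖ = 2 * (1 / (n:ℝ)^2) := by
    intro n
    rcases Nat.eq_zero_or_pos n with rfl | hn
    · simp [F]
    · have : ∀ u, ‖F n u‖ = n * (u^2 * exp (-(n*u))) := by
        intro u; simp [F]
      simp only [this]
      rw [integral_const_mul, hval n hn]; field_simp
  have hF2 : Summable fun n => ∫ u in Ioi (0:ℝ), ‖F n u‖ := by
    simp only [hnorm]
    exact hasSum_zeta_two.summable.mul_left 2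
  have hs := hasSum_integral_of_summable_integral_norm hF1 hF2
  have hv : ∀ n, ∫ u in Ioi (0:ℝ), F n u = 2 * ((-1)^(n+1) / (n:ℝ)^2) := by
    intro n
    rcases Nat.eq_zero_or_pos n with rfl | hn
    · simp [F]
    · simp only [F]
      rw [integral_const_mul, hval n hn]; field_simp
  simp only [hv] at hs
  have h2 := hs.unique (eta_two.mul_left 2)
  rw [show π^2/6 = 2 * (π^2/12) by ring, ← h2]
  refine setIntegral_congr_fun measurableSet_Ioi fun u hu => ?_
  have hu : 0 < u := hu
  have hr : ‖-exp (-u)‖ < 1 := by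
    rw [norm_neg, norm_of_nonneg (exp_pos _).le]; simpa using hu
  have := (hasSum_coe_mul_geometric_of_norm_lt_one hr).mul_left (-u^2)
  have h3 : (fun n => F n u) = fun n : ℕ => -u^2 * (n * (-exp (-u))^n) := by
    ext n
    simp only [F]
    rw [neg_pow (exp (-u)) n, ← exp_nat_mul, mul_neg, pow_succ]; ring
  simp only [h3]
  rw [this.tsum_eq, ← kap_neg u, kap]; 
  ring

lemma int_sq_kap : ∫ u, u^2 * kap u = π^2/3 := by
  have := integral_comp_abs (f := fun u => u^2 * kap u)
  simp only [kap_abs, sq_abs] at this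
  rw [this, int_sq_kap_Ioi]; ring

lemma psi_bound (s : ℝ) (hs : 0 < s) : ∃ a : ℝ, ∃ C > (0:ℝ), ∀ r : ℝ,
    |max (1+r) 0 ^ s - 1 - s*r - s*(s-1)/2*r^2 - a*r^3| ≤ C*(r^4 + |r|^(s+4)) := by
  have hO := (one_add_rpow_hasFPowerSeriesAt_zero (a := s)).isBigO_sub_partialSum_pow 4
  obtain ⟨a, ha⟩ : ∃ a, a = Ring.choose s 3 := ⟨_, rfl⟩
  have hp : ∀ y, (binomialSeries ℝ s).partialSum 4 y = 1 + s*y + s*(s-1)/2*y^2 + a*y^3 := by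
    intro y
    have h2 : Ring.choose s 2 = s*(s-1)/2 := by
      rw [Ring.choose_eq_smul]
      simp [descPochhammer_succ_right, Polynomial.smeval_mul, Polynomial.smeval_sub, Polynomial.smeval_X, Polynomial.smeval_one, descPochhammer_zero]
      ring
    simp [FormalMultilinearSeries.partialSum, Finset.sum_range_succ, binomialSeries, FormalMultilinearSeries.coeff_ofScalars, h2, ← ha]
    try ring
  obtain ⟨K, hK⟩ := hO.bound
  obtain ⟨δ, hδ, hb⟩ := Metric.eventually_nhds_iff.1 hK
  set d := min δ (1/2) with hd
  have hd0 : 0 < d := by positivity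
  have hd1 : d ≤ 1/2 := min_le_right _ _
  refine ⟨a, |K| + ((1/d+1)^s * (1/d)^4 + (1/d)^4 + |s| *(1/d)^3 + |s*(s-1)/2| *(1/d)^2 + |a| *(1/d)), by positivity, fun r => ?_⟩
  have hr4 : r^4 = |r|^4 := by rw [← abs_pow, abs_of_nonneg (by positivity)]
  have hR : 0 ≤ |r|^(s+4) := by positivity
  have hr40 : 0 ≤ r^4 := by positivity
  by_cases h : |r| < d
  · have h1 := hb (y := r) (by simpa using h.trans_le (min_le_left _ _))
    have hr := abs_lt.1 h
    rw [hp] at h1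
    have h3 : max (1+r) 0 = 1 + r := max_eq_left (by linarith)
    rw [h3]
    simp only [zero_add, norm_eq_abs, abs_pow, abs_abs] at h1
    rw [show (1+r)^s - 1 - s*r - s*(s-1)/2*r^2 - a*r^3 = (1+r)^s - (1 + s*r + s*(s-1)/2*r^2 + a*r^3) by ring]
    refine h1.trans ?_
    rw [← hr4]
    calc K * r^4 ≤ |K| * r^4 := mul_le_mul_of_nonneg_right (le_abs_self K) hr40
      _ ≤ _ := by
        apply mul_le_mul _ (by linarith) hr40 (by positivity)
        have : 0 ≤ ((1/d+1)^s * (1/d)^4 + (1/d)^4 + |s| *(1/d)^3 + |s*(s-1)/2| *(1/d)^2 + |a| *(1/d)) := by positivity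
        linarith
  · push Not at h
    have hrp : 0 < |r| := hd0.trans_le h
    have hq : 1 ≤ 1/d * |r| := by rw [one_div, inv_mul_eq_div, le_div_iff₀ hd0]; linarith
    have hpow : ∀ n : ℕ, 1 ≤ (1/d)^n * |r|^n := fun n => by
      rw [← mul_pow]; exact one_le_pow₀ hq
    have e1 : max (1+r) 0 ^ s ≤ (1/d+1)^s * (1/d)^4 * |r|^(s+4) := by
      have : max (1+r) 0 ≤ (1/d+1) * |r| := by
        apply max_le
        · have := le_abs_self r; linarith
        · positivity
      calc max (1+r) 0 ^ s ≤ ((1/d+1) * |r|)^s := rpow_le_rpow (le_max_right _ _) this hs.le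
        _ = (1/d+1)^s * |r|^s * 1 := by rw [mul_rpow (by positivity) (by positivity), mul_one]
        _ ≤ (1/d+1)^s * |r|^s * ((1/d)^4 * |r|^4) := mul_le_mul_of_nonneg_left (hpow 4) (by positivity)
        _ = _ := by
          rw [rpow_add hrp]
          have : |r| ^ (4:ℝ) = |r|^4 := by exact_mod_cast rpow_natCast |r| 4
          rw [this]; ring
    have e0 := hpow 4
    have e2 : |r| ≤ (1/d)^3 * r^4 := by
      rw [hr4]; nlinarith [mul_le_mul_of_nonneg_left (hpow 3) hrp.le]
    have e3 : |r|^2 ≤ (1/d)^2 * r^4 := by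
      rw [hr4]; nlinarith [mul_le_mul_of_nonneg_left (hpow 2) (sq_nonneg |r|)]
    have e4 : |r|^3 ≤ (1/d) * r^4 := by
      rw [hr4]; nlinarith [mul_le_mul_of_nonneg_left hq (pow_nonneg hrp.le 3)]
    rw [← hr4] at e0
    have e5 : 0 ≤ max (1+r) 0 ^ s := rpow_nonneg (le_max_right _ _) _
    have t : |max (1+r) 0 ^ s - 1 - s*r - s*(s-1)/2*r^2 - a*r^3| ≤
        max (1+r) 0 ^ s + 1 + |s| * |r| + |s*(s-1)/2| * |r|^2 + |a| * |r|^3 := by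
      rw [← abs_pow, ← abs_pow, ← abs_mul, ← abs_mul, ← abs_mul]
      have a1 := abs_sub (max (1+r) 0 ^ s - 1 - s*r - s*(s-1)/2*r^2) (a*r^3)
      have a2 := abs_sub (max (1+r) 0 ^ s - 1 - s*r) (s*(s-1)/2*r^2)
      have a3 := abs_sub (max (1+r) 0 ^ s - 1) (s*r)
      have a4 := abs_sub (max (1+r) 0 ^ s) 1
      rw [abs_of_nonneg e5, abs_one] at a4
      linarith
    have f2 := mul_le_mul_of_nonneg_left e2 (abs_nonneg s)
    have f3 := mul_le_mul_of_nonneg_left e3 (abs_nonneg (s*(s-1)/2))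
    have f4 := mul_le_mul_of_nonneg_left e4 (abs_nonneg a)
    have g1 : 0 ≤ (1/d+1)^s * (1/d)^4 * r^4 := by positivity
    have g2 : 0 ≤ |K| * (r^4 + |r|^(s+4)) := by positivity
    have g3 : 0 ≤ ((1/d)^4 + |s| *(1/d)^3 + |s*(s-1)/2| *(1/d)^2 + |a| *(1/d)) * |r|^(s+4) := by positivity
    linarith

lemma fd_ibp (s : ℝ) (hs : 0 < s) (x : ℝ) :
    IntegrableOn (fun t => t^s * kap (t-x)) (Ioi 0) ∧
    ∫ t in Ioi (0:ℝ), t ^ (s - 1) / (exp (t - x) + 1) = (1/s) * ∫ t in Ioi (0:ℝ), t^s * kap (t-x) := by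
  have hbound : ∀ t : ℝ, (exp (t-x) + 1)⁻¹ ≤ exp x * exp (-t) := by
    intro t
    rw [← exp_add, show x + -t = -(t-x) by ring, exp_neg]
    exact inv_anti₀ (exp_pos _) (by linarith)
  have hbound2 : ∀ t : ℝ, kap (t-x) ≤ exp x * exp (-t) := by
    intro t
    rw [← exp_add, show x + -t = -(t-x) by ring]
    exact kap_le_exp_neg _
  have hkc : Continuous fun t => kap (t-x) := kap_cont.comp (by fun_prop)
  have hvc : Continuous fun t : ℝ => (exp (t-x)+1)⁻¹ :=
    Continuous.inv₀ (by fun_prop) (fun t => by positivity)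
  have I1 : IntegrableOn (fun t => t^s * kap (t-x)) (Ioi 0) := by
    have h := (GammaIntegral_convergent (s := s + 1) (by linarith)).const_mul (exp x)
    refine Integrable.mono' h ?_ ?_
    · exact ((continuous_id.rpow_const (fun _ => Or.inr hs.le)).mul hkc).aestronglyMeasurable
    · refine (ae_restrict_iff' measurableSet_Ioi).2 (Eventually.of_forall fun u hu => ?_)
      have hu : 0 < u := hu
      have hp : 0 ≤ u^s := by positivity
      rw [norm_of_nonneg (mul_nonneg hp (kap_pos _).le), add_sub_cancel_right]
      have := mul_le_mul_of_nonneg_left (hbound2 u) hp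
      linarith
  have I2 : IntegrableOn (fun t => s * t^(s-1) * (exp (t-x)+1)⁻¹) (Ioi 0) := by
    have h := (GammaIntegral_convergent hs).const_mul (s * exp x)
    refine Integrable.mono' h ?_ ?_
    · refine ContinuousOn.aestronglyMeasurable ?_ measurableSet_Ioi
      refine ContinuousOn.mul (continuousOn_const.mul ?_) hvc.continuousOn
      exact continuousOn_id.rpow_const (fun t ht => Or.inl (ne_of_gt ht))
    · refine (ae_restrict_iff' measurableSet_Ioi).2 (Eventually.of_forall fun u hu => ?_)
      have hu : 0 < u := hu
      have hp : 0 ≤ s * u^(s-1) := by positivity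
      rw [norm_of_nonneg (mul_nonneg hp (by positivity))]
      have := mul_le_mul_of_nonneg_left (hbound u) hp
      linarith
  refine ⟨I1, ?_⟩
  have key := integral_Ioi_mul_deriv_eq_deriv_mul (a := 0) (a' := 0) (b' := 0)
    (u := fun t : ℝ => t^s) (v := fun t : ℝ => (exp (t-x)+1)⁻¹)
    (u' := fun t => s * t^(s-1)) (v' := fun t => -kap (t-x)) ?_ ?_ ?_ ?_ ?_ ?_
  · simp only [mul_neg, integral_neg, zero_sub, sub_zero, neg_inj] at key
    rw [key, ← integral_const_mul]
    congr 1
    ext t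
    field_simp
  · intro t ht
    exact hasDerivAt_rpow_const (Or.inl (ne_of_gt ht))
  · intro t ht
    have := ((((hasDerivAt_id t).sub_const x).exp).add_const 1).inv (by positivity)
    convert! this using 1
    simp [kap]; ring
  · convert! I1.neg using 1
    ext t; simp
  · exact I2
  · have : ContinuousAt ((fun t : ℝ => t^s) * fun t : ℝ => (exp (t-x)+1)⁻¹) 0 :=
      ((continuous_id.rpow_const (fun _ => Or.inr hs.le)).mul hvc).continuousAt
    have h2 := this.tendsto.mono_left (nhdsWithin_le_nhds (s := Ioi 0))
    simpa [zero_rpow hs.ne'] using h2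
  · have h := (tendsto_rpow_mul_exp_neg_mul_atTop_nhds_zero s 1 one_pos).const_mul (exp x)
    rw [mul_zero] at h
    refine squeeze_zero' ?_ ?_ h
    · filter_upwards [eventually_gt_atTop 0] with t ht
      simp only [Pi.mul_apply]; positivity
    · filter_upwards [eventually_gt_atTop 0] with t ht
      simp only [Pi.mul_apply]
      have := mul_le_mul_of_nonneg_left (hbound t) (rpow_nonneg ht.le s)
      simp only [neg_mul, one_mul]; linarith

lemma fd_shift (s : ℝ) (hs : 0 < s) (x : ℝ) :
    Integrable (fun u => max (x+u) 0 ^ s * kap u) ∧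
    ∫ t in Ioi (0:ℝ), t^s * kap (t-x) = ∫ u, max (x+u) 0 ^ s * kap u := by
  obtain ⟨I, -⟩ := fd_ibp s hs x
  have hind : (Ioi (0:ℝ)).indicator (fun t => t^s * kap (t-x)) = fun t => max t 0 ^ s * kap (t-x) := by
    ext t
    by_cases h : 0 < t
    · rw [indicator_of_mem (show t ∈ Ioi (0:ℝ) from h), max_eq_left h.le]
    · rw [indicator_of_notMem (show t ∉ Ioi (0:ℝ) from h), max_eq_right (not_lt.1 h), zero_rpow hs.ne', zero_mul]
  have hf : ∀ u, max (x+u) 0 ^ s * kap u = (fun t => max t 0 ^ s * kap (t-x)) (u + x) := by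
    intro u; simp [add_comm]
  simp_rw [hf]
  constructor
  · apply Integrable.comp_add_right (f := fun t => max t 0 ^ s * kap (t-x))
    rw [← hind]; exact I.integrable_indicator measurableSet_Ioi
  · rw [integral_add_right_eq_self (fun t => max t 0 ^ s * kap (t-x)) x, ← hind, integral_indicator measurableSet_Ioi]

theorem fermiDirac_sommerfeld_expansion (s : ℝ) (hs : 0 < s) :
    ∃ C > (0 : ℝ), ∃ X > (0 : ℝ), ∀ x ≥ X,
      |(∫ t in Set.Ioi (0 : ℝ), t ^ (s - 1) / (Real.exp (t - x) + 1))
          - x ^ s / s - π ^ 2 / 6 * (s - 1) * x ^ (s - 2)|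
        ≤ C * x ^ (s - 4) := by
  obtain ⟨a, C, hC, hpsi⟩ := psi_bound s hs
  set M : ℝ := ∫ u, (u^4 * kap u + |u|^(s+4) * kap u) with hM
  have i4 : Integrable (fun u => u^4 * kap u + |u|^(s+4) * kap u) :=
    (pow_kap_integrable 4).add (rpow_kap_integrable (s+4) (by linarith))
  have hM0 : 0 ≤ M := integral_nonneg fun u => by
    have := kap_pos u
    have : 0 ≤ u^4 := by positivity
    positivity
  refine ⟨1/s * (C * M) + 1, by positivity, 1, one_pos, fun x hx => ?_⟩
  have hx0 : 0 < x := by linarith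
  obtain ⟨I0, hsh⟩ := fd_shift s hs x
  rw [(fd_ibp s hs x).2, hsh]
  have x2 : x^(s-2) = x^s / x^2 := by
    rw [rpow_sub hx0]; congr 1; exact_mod_cast rpow_natCast x 2
  have x4 : x^(s-4) = x^s / x^4 := by
    rw [rpow_sub hx0]; congr 1; exact_mod_cast rpow_natCast x 4
  have hxs : 0 < x^s := by positivity
  let P : ℝ → ℝ := fun u => x^s * (u^0 * kap u) + x^s * (s/x) * (u^1 * kap u) +
    x^s * (s*(s-1)/2/x^2) * (u^2 * kap u) + x^s * (a/x^3) * (u^3 * kap u)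
  have j0 := (pow_kap_integrable 0).const_mul (x^s)
  have j1 := (pow_kap_integrable 1).const_mul (x^s * (s/x))
  have j2 := (pow_kap_integrable 2).const_mul (x^s * (s*(s-1)/2/x^2))
  have j3 := (pow_kap_integrable 3).const_mul (x^s * (a/x^3))
  have hPi : Integrable P := ((j0.add j1).add j2).add j3
  have hP : ∫ u, P u = x^s + x^s * (s*(s-1)/2/x^2) * (π^2/3) := by
    simp only [P]
    rw [integral_add (by exact (j0.add j1).add j2) j3, integral_add (by exact j0.add j1) j2, integral_add j0 j1]
    simp only [integral_const_mul]
    rw [odd_kap 1 (by decide), odd_kap 3 (by decide), int_sq_kap]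
    simp only [pow_zero, one_mul, int_kap]; ring
  have hdiff : |(∫ u, max (x+u) 0 ^ s * kap u) - ∫ u, P u| ≤ C * M * x^(s-4) := by
    rw [← integral_sub I0 hPi, ← norm_eq_abs]
    have : C * M * x^(s-4) = ∫ u, C * x^(s-4) * (u^4 * kap u + |u|^(s+4) * kap u) := by
      rw [integral_const_mul]; ring
    rw [this]
    refine norm_integral_le_of_norm_le (i4.const_mul _) (Eventually.of_forall fun u => ?_)
    have hm : max (x+u) 0 = x * max (1 + u/x) 0 := by
      rw [mul_max_of_nonneg _ _ hx0.le]; congr 1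
      · field_simp
      · simp
    have e : max (x+u) 0 ^ s * kap u - P u = x^s * kap u *
        (max (1+u/x) 0 ^ s - 1 - s*(u/x) - s*(s-1)/2*(u/x)^2 - a*(u/x)^3) := by
      simp only [P]
      rw [hm, mul_rpow hx0.le (le_max_right _ _)]
      field_simp
      ring
    have hk := kap_pos u
    rw [e, norm_mul, norm_of_nonneg (by positivity), norm_eq_abs]
    have hb := hpsi (u/x)
    have h5 : |u/x|^(s+4) ≤ |u|^(s+4) / x^4 := by
      rw [abs_div, abs_of_pos hx0, div_rpow (abs_nonneg u) hx0.le]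
      apply div_le_div_of_nonneg_left (by positivity) (by positivity)
      have : x^(4:ℝ) = x^4 := by exact_mod_cast rpow_natCast x 4
      rw [← this]
      exact rpow_le_rpow_of_exponent_le hx (by linarith)
    have h6 : C * ((u/x)^4 + |u/x|^(s+4)) ≤ C * ((u^4 + |u|^(s+4))/x^4) := by
      apply mul_le_mul_of_nonneg_left _ hC.le
      rw [div_pow, add_div]; linarith
    refine (mul_le_mul_of_nonneg_left (hb.trans h6) (by positivity)).trans (le_of_eq ?_)
    rw [x4]; ring
  have hfin : 1/s * (∫ u, max (x+u) 0 ^ s * kap u) - x^s/s - π^2/6*(s-1)*x^(s-2) =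
      1/s * ((∫ u, max (x+u) 0 ^ s * kap u) - ∫ u, P u) := by
    rw [hP, x2]; field_simp; ring
  rw [hfin, abs_mul, abs_of_pos (by positivity : 0 < 1/s)]
  have := mul_le_mul_of_nonneg_left hdiff (by positivity : 0 ≤ 1/s)
  have h7 : 0 ≤ x^(s-4) := by positivity
  linarith
end

section
/- Define φ(x) = ∫_0^∞ t^(-1/2)/(e^(t-x)+1) dt and ψ(x) = ∫_0^∞ t^(1/2)/(e^(t-x)+1) dt, and for μ > 0 let x_*(μ) be the unique real number with φ(x_*(μ)) = √(πμ). Then for every μ > 0 the function y ↦ x_*(y²) - (π/4) y² is integrable on [√μ, ∞), and the exact identity π μ/12 - x_*(μ) + (2/√(π μ)) · ψ(x_*(μ)) = (1/√μ) · ∫_{√μ}^∞ ( x_*(y²) - (π/4) y² ) dy holds. -/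
open Real MeasureTheory

/-- The Fermi-Dirac integral of index `-1/2`, continuing `Li_{1/2}` via
`Li_{1/2}(-e^x) = -φ(x)/√π`. -/
noncomputable def fermiDiracHalf (x : ℝ) : ℝ :=
  ∫ t in Set.Ioi (0 : ℝ), t ^ (-(1 : ℝ) / 2) / (Real.exp (t - x) + 1)

/-- The Fermi-Dirac integral of index `1/2`, continuing `Li_{3/2}` via
`Li_{3/2}(-e^x) = -(2/√π)ψ(x)`. -/
noncomputable def fermiDiracThreeHalf (x : ℝ) : ℝ :=
  ∫ t in Set.Ioi (0 : ℝ), t ^ ((1 : ℝ) / 2) / (Real.exp (t - x) + 1)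

/-- Logistic density. -/
noncomputable def kk (v : ℝ) : ℝ := Real.exp v / (Real.exp v + 1) ^ 2

lemma kk_pos (v : ℝ) : 0 < kk v := by unfold kk; positivity

lemma kk_cont : Continuous kk := by
  unfold kk
  refine Continuous.div (by fun_prop) (by fun_prop) fun v => ?_
  positivity

lemma kk_neg (v : ℝ) : kk (-v) = kk v := by
  unfold kk
  rw [Real.exp_neg]
  have := Real.exp_pos v
  field_simp
  ring

lemma kk_bound (v : ℝ) : (1 + v ^ 2) * kk v ≤ 50 * (1 + v ^ 2)⁻¹ := by
  wlog h : 0 ≤ v with H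
  · have := H (-v) (by linarith)
    rw [kk_neg] at this
    simpa using this
  have h1 : v ^ 4 / 24 ≤ Real.exp v := by
    have := Real.pow_div_factorial_le_exp v h 4
    simpa [Nat.factorial] using this
  have h0 := Real.exp_pos v
  unfold kk
  rw [← div_eq_mul_inv, mul_div_assoc', div_le_div_iff₀ (by positivity) (by positivity)]
  have h2 : (1 + v ^ 2) ^ 2 ≤ 50 * (Real.exp v + 1) := by
    nlinarith [sq_nonneg (v ^ 2 - 1)]
  nlinarith [mul_le_mul_of_nonneg_right h2 h0.le]

/-- domination -/
lemma integrable_mul_kk {f : ℝ → ℝ} (hf : Continuous f) (C : ℝ)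
    (h : ∀ v, |f v| ≤ C * (1 + v ^ 2)) : Integrable (fun v => f v * kk v) := by
  refine Integrable.mono' ((integrable_inv_one_add_sq).const_mul (C * 50))
    (hf.mul kk_cont).aestronglyMeasurable (Filter.Eventually.of_forall fun v => ?_)
  have hC : 0 ≤ C := by
    have := (abs_nonneg _).trans (h 0)
    simpa using this
  rw [Real.norm_eq_abs, abs_mul, abs_of_pos (kk_pos v)]
  calc |f v| * kk v ≤ C * (1 + v ^ 2) * kk v :=
        mul_le_mul_of_nonneg_right (h v) (kk_pos v).le
    _ = C * ((1 + v ^ 2) * kk v) := by ring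
    _ ≤ C * (50 * (1 + v ^ 2)⁻¹) := mul_le_mul_of_nonneg_left (kk_bound v) hC
    _ = _ := by ring

lemma integrable_kk : Integrable kk := by
  have := integrable_mul_kk (f := fun _ => 1) continuous_const 1 (by intro v; simp; positivity)
  simpa using this

lemma integrable_id_kk : Integrable (fun v => v * kk v) :=
  integrable_mul_kk continuous_id 1 (by
    intro v; rw [abs_le]; constructor <;> nlinarith [sq_nonneg (v-1), sq_nonneg (v+1)])

lemma integrable_sq_kk : Integrable (fun v => v ^ 2 * kk v) :=
  integrable_mul_kk (by fun_prop) 1 (by intro v; rw [abs_of_nonneg (sq_nonneg v)]; linarith)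

lemma hasDerivAt_ff (v : ℝ) : HasDerivAt (fun v => 1 / (Real.exp v + 1)) (-kk v) v := by
  have h := ((Real.hasDerivAt_exp v).add_const 1).inv (by positivity)
  have e : (fun v => 1 / (Real.exp v + 1)) = (fun v => Real.exp v + 1)⁻¹ := by
    ext; simp
  rw [e]
  have e2 : -kk v = -Real.exp v / (Real.exp v + 1) ^ 2 := by unfold kk; ring
  rw [e2]
  exact h

lemma integral_kk : ∫ v, kk v = 1 := by
  have h := integral_of_hasDerivAt_of_tendsto (f := fun v => -(1 / (Real.exp v + 1)))
    (f' := kk) (m := -1) (n := 0) (fun v => by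
      have h := (hasDerivAt_ff v).neg
      rw [neg_neg] at h
      exact h) integrable_kk
    (by
      have : Filter.Tendsto (fun v : ℝ => -(1 / (Real.exp v + 1))) Filter.atBot
          (nhds (-(1 / (0 + 1)))) :=
        ((tendsto_const_nhds).div (Real.tendsto_exp_atBot.add_const 1) (by norm_num)).neg
      simpa using this)
    (by
      have : Filter.Tendsto (fun v : ℝ => -(1 / (Real.exp v + 1))) Filter.atTop
          (nhds (-0)) :=
        ((tendsto_const_nhds).div_atTop
          (Filter.tendsto_atTop_add_const_right _ 1 Real.tendsto_exp_atTop)).neg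
      simpa using this)
  rw [h]; norm_num

lemma integral_id_kk : ∫ v, v * kk v = 0 := by
  have h := integral_neg_eq_self (fun v => v * kk v) (volume : Measure ℝ)
  simp only [kk_neg, neg_mul] at h
  rw [integral_neg] at h
  linarith

/-- smoothed square root -/
noncomputable def AA (x : ℝ) : ℝ := ∫ v, √(x + v) * kk v
/-- smoothed 3/2 power -/
noncomputable def BB (x : ℝ) : ℝ := ∫ v, √(x + v) ^ 3 * kk v

lemma sqrt4_le (x v : ℝ) : √(x + v) ^ 4 ≤ 2 * x ^ 2 + 2 * v ^ 2 := by
  rcases le_total 0 (x + v) with h | h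
  · have : √(x + v) ^ 4 = (x + v) ^ 2 := by
      rw [show √(x + v) ^ 4 = (√(x + v) ^ 2) ^ 2 by ring, Real.sq_sqrt h]
    rw [this]; nlinarith [sq_nonneg (x - v)]
  · rw [Real.sqrt_eq_zero_of_nonpos h]; nlinarith [sq_nonneg x, sq_nonneg v]

lemma integrable_A (x : ℝ) : Integrable (fun v => √(x + v) * kk v) :=
  integrable_mul_kk (by fun_prop) (2 + 2 * x ^ 2) (by
    intro v
    have h := sqrt4_le x v
    have h0 := Real.sqrt_nonneg (x + v)
    rw [abs_of_nonneg h0]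
    nlinarith [sq_nonneg (√(x + v) ^ 2 - 1), sq_nonneg (√(x + v) - 1), mul_nonneg (sq_nonneg x) (sq_nonneg v)])

lemma integrable_B (x : ℝ) : Integrable (fun v => √(x + v) ^ 3 * kk v) :=
  integrable_mul_kk (by fun_prop) (2 + 2 * x ^ 2) (by
    intro v
    have h := sqrt4_le x v
    have h0 := Real.sqrt_nonneg (x + v)
    rw [abs_of_nonneg (by positivity)]
    set s := √(x + v)
    have : s ^ 3 ≤ 1 + s ^ 4 := by nlinarith [sq_nonneg (s ^ 2 - s), sq_nonneg (s ^ 2 - 1), sq_nonneg (s - 1)]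
    nlinarith [mul_nonneg (sq_nonneg x) (sq_nonneg v), sq_nonneg v])

lemma A_strictMono : StrictMono AA := by
  intro a b hab
  have h : 0 < ∫ v, (√(b + v) * kk v - √(a + v) * kk v) := by
    refine integral_pos_of_integrable_nonneg_nonzero (x := -a) ?_
      ((integrable_A b).sub (integrable_A a)) ?_ ?_
    · have := kk_cont
      fun_prop
    · intro v
      have : √(a + v) ≤ √(b + v) := Real.sqrt_le_sqrt (by linarith)
      have := mul_le_mul_of_nonneg_right this (kk_pos v).le
      simp only [Pi.zero_apply]; linarith
    · have h1 : 0 < √(b + -a) := Real.sqrt_pos.2 (by linarith)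
      have := mul_pos h1 (kk_pos (-a))
      simp only [add_neg_cancel, Real.sqrt_zero, zero_mul, sub_zero]
      exact this.ne'
  rw [integral_sub (integrable_A b) (integrable_A a)] at h
  unfold AA; linarith

lemma B_convex (a b : ℝ) : 3 / 2 * AA a * (b - a) ≤ BB b - BB a := by
  unfold AA BB
  rw [← integral_sub (integrable_B b) (integrable_B a)]
  have : 3 / 2 * (∫ v, √(a + v) * kk v) * (b - a)
      = ∫ v, (3 / 2 * (b - a)) * (√(a + v) * kk v) := by
    rw [integral_const_mul]; ring
  rw [this]
  refine integral_mono ((integrable_A a).const_mul _) ((integrable_B b).sub (integrable_B a)) ?_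
  intro v
  have hk := (kk_pos v).le
  have key : (3 / 2 * (b - a)) * √(a + v) ≤ √(b + v) ^ 3 - √(a + v) ^ 3 := by
    have hp := Real.sqrt_nonneg (a + v)
    have hq := Real.sqrt_nonneg (b + v)
    have hq2 : b + v ≤ √(b + v) ^ 2 := by
      rcases le_total 0 (b + v) with h | h
      · rw [Real.sq_sqrt h]
      · exact h.trans (sq_nonneg _)
    rcases le_total 0 (a + v) with h | h
    · have hp2 := Real.sq_sqrt h
      set p := √(a + v)
      set q := √(b + v)
      have : b - a ≤ q ^ 2 - p ^ 2 := by linarith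
      have h3 : (b - a) * p ≤ (q ^ 2 - p ^ 2) * p := mul_le_mul_of_nonneg_right this hp
      have : 0 ≤ (q - p) ^ 2 * (q + p / 2) := by positivity
      nlinarith
    · rw [Real.sqrt_eq_zero_of_nonpos h]
      simp
  have := mul_le_mul_of_nonneg_right key hk
  linarith

/-- second moment -/
noncomputable def MM : ℝ := ∫ v, v ^ 2 * kk v

lemma MM_nonneg : 0 ≤ MM := integral_nonneg fun v => mul_nonneg (sq_nonneg v) (kk_pos v).le

lemma approx_gen {f : ℝ → ℝ} (hf : Integrable (fun v => f v * kk v)) (p q C : ℝ)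
    (h : ∀ v, |f v - p - q * v| ≤ C * v ^ 2) :
    |(∫ v, f v * kk v) - p| ≤ C * MM := by
  have e : (∫ v, f v * kk v) - p = ∫ v, (f v * kk v - p * kk v - q * (v * kk v)) := by
    have hi : Integrable (fun v => f v * kk v - p * kk v) := hf.sub (integrable_kk.const_mul p)
    rw [integral_sub hi (integrable_id_kk.const_mul q),
      integral_sub hf (integrable_kk.const_mul p), integral_const_mul, integral_const_mul,
      integral_kk, integral_id_kk]
    ring
  rw [e, MM, ← integral_const_mul, ← Real.norm_eq_abs]
  refine norm_integral_le_of_norm_le (integrable_sq_kk.const_mul C)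
    (Filter.Eventually.of_forall fun v => ?_)
  have : f v * kk v - p * kk v - q * (v * kk v) = (f v - p - q * v) * kk v := by ring
  rw [this, Real.norm_eq_abs, abs_mul, abs_of_pos (kk_pos v), ← mul_assoc]
  exact mul_le_mul_of_nonneg_right (h v) (kk_pos v).le

lemma A_approx (r : ℝ) (hr : 0 < r) : |AA (r ^ 2) - r| ≤ 1 / r ^ 3 * MM := by
  refine approx_gen (integrable_A _) r (1 / (2 * r)) _ fun v => ?_
  have e : √(r ^ 2 + v) - r - 1 / (2 * r) * v
      = (2 * r ^ 3 * √(r ^ 2 + v) - 2 * r ^ 4 - r ^ 2 * v) / (2 * r ^ 3) := by field_simp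
  rw [e, abs_div, abs_of_pos (show 0 < 2 * r ^ 3 by positivity), div_le_iff₀ (by positivity)]
  have e2 : 1 / r ^ 3 * v ^ 2 * (2 * r ^ 3) = 2 * v ^ 2 := by field_simp
  rw [e2]
  rcases le_total 0 (r ^ 2 + v) with h | h
  · have hs := Real.sq_sqrt h
    have h0 := Real.sqrt_nonneg (r ^ 2 + v)
    set s := √(r ^ 2 + v)
    have hv : v = s ^ 2 - r ^ 2 := by linarith
    have : 2 * r ^ 3 * s - 2 * r ^ 4 - r ^ 2 * v = -((s - r) ^ 2 * r ^ 2) := by rw [hv]; ring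
    rw [this, abs_neg, abs_of_nonneg (by positivity), hv]
    have : (s ^ 2 - r ^ 2) ^ 2 = (s - r) ^ 2 * (s + r) ^ 2 := by ring
    rw [this]
    have : r ^ 2 ≤ (s + r) ^ 2 := by nlinarith
    nlinarith [mul_le_mul_of_nonneg_left this (sq_nonneg (s - r)), mul_nonneg (sq_nonneg (s-r)) (sq_nonneg (s+r))]
  · rw [Real.sqrt_eq_zero_of_nonpos h, abs_le]
    constructor <;> nlinarith [sq_nonneg v, mul_nonneg (sq_nonneg r) (sq_nonneg r), sq_nonneg r]

lemma B_approx (r : ℝ) (hr : 0 < r) : |BB (r ^ 2) - r ^ 3| ≤ 2 / r * MM := by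
  refine approx_gen (integrable_B _) (r ^ 3) (3 / 2 * r) _ fun v => ?_
  have e2 : 2 / r * v ^ 2 = (2 * v ^ 2) / r := by ring
  rw [e2, le_div_iff₀ hr]
  rcases le_total 0 (r ^ 2 + v) with h | h
  · have hs := Real.sq_sqrt h
    have h0 := Real.sqrt_nonneg (r ^ 2 + v)
    set s := √(r ^ 2 + v)
    have hv : v = s ^ 2 - r ^ 2 := by linarith
    have : s ^ 3 - r ^ 3 - 3 / 2 * r * v = (s - r) ^ 2 * (s + r / 2) := by rw [hv]; ring
    rw [this, abs_of_nonneg (by positivity), hv]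
    have : (s ^ 2 - r ^ 2) ^ 2 = (s - r) ^ 2 * (s + r) ^ 2 := by ring
    rw [this]
    have : (s + r / 2) * r ≤ 2 * (s + r) ^ 2 := by nlinarith [mul_nonneg h0 hr.le]
    nlinarith [mul_le_mul_of_nonneg_left this (sq_nonneg (s - r))]
  · rw [Real.sqrt_eq_zero_of_nonpos h]
    have : |(0:ℝ) ^ 3 - r ^ 3 - 3 / 2 * r * v| * r = |-(r ^ 4) - 3 / 2 * r ^ 2 * v| := by
      rw [← abs_of_pos hr, ← abs_mul, abs_of_pos hr]; congr 1; ring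
    rw [this, abs_le]
    have h1 : r ^ 2 * r ^ 2 ≤ r ^ 2 * (-v) := mul_le_mul_of_nonneg_left (by linarith) (sq_nonneg r)
    have h2 : r ^ 2 * (-v) ≤ (-v) * (-v) := mul_le_mul_of_nonneg_right (by linarith) (by nlinarith [sq_nonneg r])
    constructor <;> nlinarith [sq_nonneg v, mul_nonneg (sq_nonneg r) (sq_nonneg r)]

lemma ff_le (x t : ℝ) : 1 / (Real.exp (t - x) + 1) ≤ Real.exp x * Real.exp (-t) := by
  rw [← Real.exp_add, show x + -t = -(t - x) by ring, Real.exp_neg, one_div]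
  exact inv_anti₀ (Real.exp_pos _) (by linarith)

lemma kk_le (x t : ℝ) : kk (t - x) ≤ Real.exp x * Real.exp (-t) := by
  refine le_trans ?_ (ff_le x t)
  unfold kk
  have := Real.exp_pos (t - x)
  rw [div_le_div_iff₀ (by positivity) (by positivity)]
  nlinarith

lemma int_gen {h : ℝ → ℝ} (hc : Continuous h) (h0 : ∀ t, 0 ≤ h t) (C : ℝ)
    (hle : ∀ t, h t ≤ C * Real.exp (-t)) (s : ℝ) (hs : 0 < s) :
    IntegrableOn (fun t => t ^ (s - 1) * h t) (Set.Ioi 0) := by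
  refine Integrable.mono' ((Real.GammaIntegral_convergent hs).const_mul C) ?_ ?_
  · refine ContinuousOn.aestronglyMeasurable ?_ measurableSet_Ioi
    refine ContinuousOn.mul ?_ hc.continuousOn
    intro t ht
    exact (Real.continuousAt_rpow_const t _ (Or.inl (ne_of_gt ht))).continuousWithinAt
  · refine (ae_restrict_iff' measurableSet_Ioi).2 (Filter.Eventually.of_forall fun t ht => ?_)
    have ht0 : 0 ≤ t ^ (s - 1) := Real.rpow_nonneg (le_of_lt ht) _
    rw [Real.norm_eq_abs, abs_of_nonneg (mul_nonneg ht0 (h0 t))]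
    have := mul_le_mul_of_nonneg_left (hle t) ht0
    linarith

lemma ibp (x s : ℝ) (hs : 0 < s) :
    s * ∫ t in Set.Ioi (0 : ℝ), t ^ (s - 1) / (Real.exp (t - x) + 1)
      = ∫ t in Set.Ioi (0 : ℝ), t ^ s * kk (t - x) := by
  have i1 : IntegrableOn (fun t => t ^ (s - 1) * (1 / (Real.exp (t - x) + 1))) (Set.Ioi 0) := by
    refine int_gen ?_ (fun t => by positivity) _ (ff_le x) s hs
    refine Continuous.div (by fun_prop) (by fun_prop) fun v => ?_
    positivity
  have i2 : IntegrableOn (fun t => t ^ s * kk (t - x)) (Set.Ioi 0) := by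
    have := int_gen (h := fun t => kk (t - x)) (kk_cont.comp (by fun_prop))
      (fun t => (kk_pos _).le) _ (kk_le x) (s + 1) (by linarith)
    simpa using this
  have i3 := (i1.const_mul s).sub i2
  have key := integral_Ioi_of_hasDerivAt_of_tendsto (a := 0) (m := 0)
    (f := fun t => t ^ s * (1 / (Real.exp (t - x) + 1)))
    (f' := fun t => s * (t ^ (s - 1) * (1 / (Real.exp (t - x) + 1))) - t ^ s * kk (t - x))
    ?_ ?_ i3 ?_
  · rw [integral_sub (i1.const_mul s) i2, integral_const_mul, Real.zero_rpow hs.ne'] at key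
    have e : ∀ t : ℝ, t ^ (s - 1) / (Real.exp (t - x) + 1)
      = t ^ (s - 1) * (1 / (Real.exp (t - x) + 1)) := fun t => by ring
    simp only [e]
    linarith
  · refine (ContinuousAt.mul (Real.continuousAt_rpow_const _ _ (Or.inr hs.le)) ?_).continuousWithinAt
    exact ((hasDerivAt_ff (0 - x)).continuousAt).comp
      (f := fun t : ℝ => t - x) (by fun_prop)
  · intro t ht
    have h1 := Real.hasDerivAt_rpow_const (x := t) (p := s) (Or.inl (ne_of_gt ht))
    have h2 := (hasDerivAt_ff (t - x)).comp_sub_const t x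
    have e : s * (t ^ (s - 1) * (1 / (Real.exp (t - x) + 1))) - t ^ s * kk (t - x)
        = s * t ^ (s - 1) * (1 / (Real.exp (t - x) + 1)) + t ^ s * -kk (t - x) := by ring
    simp only [e]
    exact h1.mul h2
  · have h := (tendsto_rpow_mul_exp_neg_mul_atTop_nhds_zero s 1 one_pos).const_mul (Real.exp x)
    rw [mul_zero] at h
    refine squeeze_zero' ?_ ?_ h
    · filter_upwards [Filter.eventually_ge_atTop 0] with t ht
      have := Real.rpow_nonneg ht s
      positivity
    · filter_upwards [Filter.eventually_ge_atTop 0] with t ht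
      have := Real.rpow_nonneg ht s
      have := mul_le_mul_of_nonneg_left (ff_le x t) this
      rw [neg_one_mul]
      linarith

lemma shift (x : ℝ) (h : ℝ → ℝ) (h0 : ∀ t ≤ 0, h t = 0) :
    ∫ t in Set.Ioi (0 : ℝ), h t * kk (t - x) = ∫ v, h (x + v) * kk v := by
  rw [setIntegral_eq_integral_of_forall_compl_eq_zero]
  · rw [← integral_add_left_eq_self (μ := volume) (fun t => h t * kk (t - x)) x]
    simp
  · intro t ht
    rw [h0 t (by simpa using ht), zero_mul]

lemma half_eq (x : ℝ) : fermiDiracHalf x = 2 * AA x := by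
  have h := ibp x (1 / 2) (by norm_num)
  have h2 := shift x (fun t => √t) (fun t ht => Real.sqrt_eq_zero_of_nonpos ht)
  have h3 : ∫ t in Set.Ioi (0 : ℝ), t ^ (1 / 2 : ℝ) * kk (t - x)
      = ∫ t in Set.Ioi (0 : ℝ), √t * kk (t - x) := by
    simp only [Real.sqrt_eq_rpow]
  unfold fermiDiracHalf AA
  rw [h3, h2] at h
  rw [show (-(1:ℝ) / 2) = 1 / 2 - 1 by norm_num]
  linarith

lemma threeHalf_eq (x : ℝ) : fermiDiracThreeHalf x = 2 / 3 * BB x := by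
  have h := ibp x (3 / 2) (by norm_num)
  have h2 := shift x (fun t => √t ^ 3) (fun t ht => by simp [Real.sqrt_eq_zero_of_nonpos ht])
  have h3 : ∫ t in Set.Ioi (0 : ℝ), t ^ (3 / 2 : ℝ) * kk (t - x)
      = ∫ t in Set.Ioi (0 : ℝ), √t ^ 3 * kk (t - x) := by
    refine setIntegral_congr_fun measurableSet_Ioi fun t ht => ?_
    have ht0 : (0:ℝ) ≤ t := le_of_lt ht
    simp only [Real.sqrt_eq_rpow]
    rw [← Real.rpow_natCast, ← Real.rpow_mul ht0]
    norm_num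
  unfold fermiDiracThreeHalf BB
  rw [h3, h2] at h
  rw [show ((1:ℝ) / 2) = 3 / 2 - 1 by norm_num]
  linarith

lemma A_pos (x : ℝ) : 0 < AA x := by
  have h : 0 ≤ AA (x - 1) :=
    integral_nonneg fun v => mul_nonneg (Real.sqrt_nonneg _) (kk_pos v).le
  exact h.trans_lt (A_strictMono (by linarith))

section inverse

variable {X : ℝ → ℝ} {c : ℝ}

lemma X_strictMono (hc : 0 < c) (hX : ∀ y, 0 < y → AA (X y) = c * y) :
    StrictMonoOn X (Set.Ioi 0) := by
  intro y hy z hz hyz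
  rw [← A_strictMono.lt_iff_lt, hX y hy, hX z hz]
  exact mul_lt_mul_of_pos_left hyz hc

lemma X_surj (hc : 0 < c) (hX : ∀ y, 0 < y → AA (X y) = c * y) (x : ℝ) :
    ∃ y, 0 < y ∧ X y = x := by
  have h := div_pos (A_pos x) hc
  refine ⟨AA x / c, h, A_strictMono.injective ?_⟩
  rw [hX _ h]
  field_simp

lemma X_cont (hc : 0 < c) (hX : ∀ y, 0 < y → AA (X y) = c * y) (y : ℝ) (hy : 0 < y) :
    ContinuousAt X y := by
  refine (X_strictMono hc hX).continuousAt_of_image_mem_nhds (Ioi_mem_nhds hy) ?_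
  have : X '' Set.Ioi 0 = Set.univ := by
    ext x
    obtain ⟨z, hz, e⟩ := X_surj hc hX x
    exact ⟨fun _ => trivial, fun _ => ⟨z, hz, e⟩⟩
  rw [this]; exact Filter.univ_mem

lemma X_tendsto (hc : 0 < c) (hX : ∀ y, 0 < y → AA (X y) = c * y) :
    Filter.Tendsto X Filter.atTop Filter.atTop := by
  refine Filter.tendsto_atTop.2 fun b => ?_
  obtain ⟨z, hz, e⟩ := X_surj hc hX b
  filter_upwards [Filter.eventually_ge_atTop z] with y hy
  rw [← e]
  exact (X_strictMono hc hX).monotoneOn hz (lt_of_lt_of_le hz hy) hy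

/-- Legendre transform -/
lemma L_ineq (hc : 0 < c) (hX : ∀ y, 0 < y → AA (X y) = c * y) (y z : ℝ) (hy : 0 < y) :
    (z * X z - 2 / (3 * c) * BB (X z)) - (y * X y - 2 / (3 * c) * BB (X y)) ≤ (z - y) * X z := by
  have h := B_convex (X y) (X z)
  rw [hX y hy] at h
  have h2 := mul_le_mul_of_nonneg_left h (show 0 ≤ 2 / (3 * c) by positivity)
  have e : 2 / (3 * c) * (3 / 2 * (c * y) * (X z - X y)) = y * (X z - X y) := by field_simp
  rw [e] at h2
  linarith

lemma L_deriv (hc : 0 < c) (hX : ∀ y, 0 < y → AA (X y) = c * y) (y : ℝ) (hy : 0 < y) :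
    HasDerivAt (fun y => y * X y - 2 / (3 * c) * BB (X y)) (X y) y := by
  rw [hasDerivAt_iff_isLittleO, Asymptotics.isLittleO_iff]
  intro ε hε
  have hcont := X_cont hc hX y hy
  filter_upwards [Ioi_mem_nhds hy, Metric.continuousAt_iff'.1 hcont ε hε] with z hz hd
  have h1 := L_ineq hc hX y z hy
  have h2 := L_ineq hc hX z y hz
  rw [Real.dist_eq] at hd
  rw [smul_eq_mul, Real.norm_eq_abs, Real.norm_eq_abs]
  set Lz := z * X z - 2 / (3 * c) * BB (X z)
  set Ly := y * X y - 2 / (3 * c) * BB (X y)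
  have h3 : 0 ≤ Lz - Ly - (z - y) * X y := by linarith
  rw [abs_of_nonneg h3]
  calc Lz - Ly - (z - y) * X y ≤ (X z - X y) * (z - y) := by linarith
    _ ≤ |(X z - X y) * (z - y)| := le_abs_self _
    _ = |X z - X y| * |z - y| := abs_mul _ _
    _ ≤ ε * |z - y| := mul_le_mul_of_nonneg_right hd.le (abs_nonneg _)

/-- pointwise asymptotic bounds in terms of r = √X -/
lemma asym (r : ℝ) (hr : 1 ≤ r) :
    |r ^ 2 - AA (r ^ 2) ^ 2| ≤ MM * (2 + MM) * (1 + MM) ^ 2 / AA (r ^ 2) ^ 2 ∧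
    |AA (r ^ 2) ^ 3 - 3 * r ^ 2 * AA (r ^ 2) + 2 * BB (r ^ 2)|
      ≤ (MM ^ 2 * (3 + MM) + 4 * MM) / r := by
  have hr0 : 0 < r := by linarith
  have hA := A_approx r hr0
  have hB := B_approx r hr0
  have hM := MM_nonneg
  have hp := A_pos (r ^ 2)
  set A := AA (r ^ 2)
  set B := BB (r ^ 2)
  have hinv : 1 / r ^ 3 * MM ≤ MM / r ^ 2 / r := le_of_eq (by field_simp)
  have hA1 : |A - r| ≤ MM := by
    refine hA.trans ?_
    rw [div_mul_eq_mul_div, one_mul]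
    exact div_le_self hM (one_le_pow₀ hr)
  have hAle : A ≤ (1 + MM) * r := by
    have := (abs_le.1 hA1).2
    nlinarith
  have hsum : A + r ≤ (2 + MM) * r := by linarith
  constructor
  · have e : r ^ 2 - A ^ 2 = -((A - r) * (A + r)) := by ring
    rw [e, abs_neg, abs_mul, abs_of_pos (show 0 < A + r by linarith)]
    calc |A - r| * (A + r) ≤ (1 / r ^ 3 * MM) * ((2 + MM) * r) := by gcongr
      _ = MM * (2 + MM) / r ^ 2 := by field_simp
      _ ≤ _ := by
        rw [div_le_div_iff₀ (by positivity) (by positivity)]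
        have : A ^ 2 ≤ ((1 + MM) * r) ^ 2 := by gcongr
        calc MM * (2 + MM) * A ^ 2 ≤ MM * (2 + MM) * ((1 + MM) * r) ^ 2 := by gcongr
          _ = _ := by ring
  · have e : A ^ 3 - 3 * r ^ 2 * A + 2 * B = (A - r) ^ 2 * (A + 2 * r) + 2 * (B - r ^ 3) := by ring
    rw [e]
    refine (abs_add_le _ _).trans ?_
    rw [abs_mul, abs_mul, abs_pow, abs_of_pos (show 0 < A + 2 * r by linarith),
      abs_of_pos (show (0:ℝ) < 2 by norm_num)]
    have h1 : |A - r| ^ 2 * (A + 2 * r) ≤ (1 / r ^ 3 * MM) ^ 2 * ((3 + MM) * r) := by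
      gcongr; linarith
    have h2 : (1 / r ^ 3 * MM) ^ 2 * ((3 + MM) * r) = MM ^ 2 * (3 + MM) / r / r ^ 4 := by
      field_simp
    have h3 : MM ^ 2 * (3 + MM) / r / r ^ 4 ≤ MM ^ 2 * (3 + MM) / r :=
      div_le_self (by positivity) (one_le_pow₀ hr)
    have h4 : (MM ^ 2 * (3 + MM) + 4 * MM) / r = MM ^ 2 * (3 + MM) / r + 2 * (2 / r * MM) := by
      field_simp; ring
    rw [h4]
    linarith

lemma G_tendsto (hc : 0 < c) (hX : ∀ y, 0 < y → AA (X y) = c * y) :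
    Filter.Tendsto (fun y => c ^ 2 * y ^ 3 / 3 - (y * X y - 2 / (3 * c) * BB (X y)))
      Filter.atTop (nhds 0) := by
  have ht : Filter.Tendsto (fun y => 1 / (3 * c) * ((MM ^ 2 * (3 + MM) + 4 * MM) / √(X y)))
      Filter.atTop (nhds (1 / (3 * c) * 0)) :=
    (tendsto_const_nhds.div_atTop (Real.tendsto_sqrt_atTop.comp (X_tendsto hc hX))).const_mul _
  rw [mul_zero] at ht
  refine squeeze_zero_norm' ?_ ht
  filter_upwards [(X_tendsto hc hX).eventually_ge_atTop 1, Filter.eventually_gt_atTop 0]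
    with y h1 h0
  have h := (asym (√(X y)) (by rw [Real.one_le_sqrt]; exact h1)).2
  rw [Real.sq_sqrt (by linarith)] at h
  have e : c ^ 2 * y ^ 3 / 3 - (y * X y - 2 / (3 * c) * BB (X y))
      = 1 / (3 * c) * (AA (X y) ^ 3 - 3 * X y * AA (X y) + 2 * BB (X y)) := by
    rw [hX y h0]; field_simp; ring
  rw [e, Real.norm_eq_abs, abs_mul, abs_of_pos (show 0 < 1 / (3 * c) by positivity)]
  exact mul_le_mul_of_nonneg_left h (by positivity)

lemma g_integrable (hc : 0 < c) (hX : ∀ y, 0 < y → AA (X y) = c * y) (a : ℝ) (ha : 0 < a) :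
    IntegrableOn (fun y => X y - c ^ 2 * y ^ 2) (Set.Ici a) := by
  have hco : ContinuousOn (fun y => X y - c ^ 2 * y ^ 2) (Set.Ici a) := by
    intro y hy
    have := X_cont hc hX y (lt_of_lt_of_le ha hy)
    exact (this.sub (by fun_prop)).continuousWithinAt
  refine (hco.locallyIntegrableOn measurableSet_Ici).integrableOn_of_isBigO_atTop
    (g := fun y => y ^ (-2 : ℝ)) ?_ ?_
  · refine Asymptotics.isBigO_iff.2 ⟨MM * (2 + MM) * (1 + MM) ^ 2 / c ^ 2, ?_⟩
    filter_upwards [(X_tendsto hc hX).eventually_ge_atTop 1, Filter.eventually_gt_atTop 0]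
      with y h1 h0
    have h := (asym (√(X y)) (by rw [Real.one_le_sqrt]; exact h1)).1
    rw [Real.sq_sqrt (by linarith), hX y h0, mul_pow] at h
    rw [Real.norm_eq_abs, Real.norm_eq_abs, abs_of_pos (Real.rpow_pos_of_pos h0 _),
      Real.rpow_neg h0.le, Real.rpow_two]
    refine h.trans (le_of_eq ?_)
    field_simp
  · exact integrableAtFilter_rpow_atTop_iff.mpr (by norm_num)

lemma g_integral (hc : 0 < c) (hX : ∀ y, 0 < y → AA (X y) = c * y) (a : ℝ) (ha : 0 < a) :
    ∫ y in Set.Ioi a, (X y - c ^ 2 * y ^ 2)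
      = c ^ 2 * a ^ 3 / 3 - (a * X a - 2 / (3 * c) * BB (X a)) := by
  have hi := (g_integrable hc hX a ha).mono_set Set.Ioi_subset_Ici_self
  have h := integral_Ioi_of_hasDerivAt_of_tendsto' (a := a) (m := 0)
    (f := fun y => c ^ 2 * y ^ 3 / 3 - (y * X y - 2 / (3 * c) * BB (X y)))
    (f' := fun y => -(X y - c ^ 2 * y ^ 2)) ?_ hi.neg (G_tendsto hc hX)
  · rw [integral_neg] at h
    linarith
  · intro y hy
    have h1 := L_deriv hc hX y (lt_of_lt_of_le ha hy)
    have h2 : HasDerivAt (fun y : ℝ => c ^ 2 * y ^ 3 / 3) (c ^ 2 * y ^ 2) y := by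
      have := ((hasDerivAt_pow 3 y).const_mul (c ^ 2)).div_const 3
      have e : c ^ 2 * y ^ 2 = c ^ 2 * (((3 : ℕ) : ℝ) * y ^ (3 - 1)) / 3 := by
        push_cast; ring
      rw [e]
      exact this
    have h3 := h2.sub h1
    rw [neg_sub]
    exact h3

end inverse

/-- The exact relation (eq. (bella)) of the paper, expressing the
double-scaling free energy of `U(N)` Yang-Mills theory on the torus evaluated
at the saddle point `z_* = e^{x_*(μ)}` as a primitive of the saddle-point
position: if `x_*` solves `φ(x_*(μ)) = √(πμ)` for all `μ > 0`, then for every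
`μ > 0` the function `y ↦ x_*(y²) - (π/4)y²` is integrable on `[√μ, ∞)` and
`πμ/12 - x_*(μ) + (2/√(πμ)) ψ(x_*(μ)) = (1/√μ) ∫_{√μ}^∞ (x_*(y²) - (π/4)y²) dy`. -/
theorem free_energy_primitive_of_saddle (xstar : ℝ → ℝ)
    (hx : ∀ μ : ℝ, 0 < μ → fermiDiracHalf (xstar μ) = Real.sqrt (π * μ)) :
    ∀ μ : ℝ, 0 < μ →
      IntegrableOn (fun y : ℝ => xstar (y ^ 2) - π / 4 * y ^ 2)
          (Set.Ici (Real.sqrt μ)) ∧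
        π * μ / 12 - xstar μ
            + 2 / Real.sqrt (π * μ) * fermiDiracThreeHalf (xstar μ)
          = (1 / Real.sqrt μ) *
              ∫ y in Set.Ioi (Real.sqrt μ), (xstar (y ^ 2) - π / 4 * y ^ 2) := by
  intro μ hμ
  have hc : 0 < √π / 2 := by positivity
  have hc2 : (√π / 2) ^ 2 = π / 4 := by
    rw [div_pow, Real.sq_sqrt Real.pi_pos.le]; norm_num
  have hX : ∀ y, 0 < y → AA ((fun y => xstar (y ^ 2)) y) = √π / 2 * y := by
    intro y hy
    have h := hx (y ^ 2) (by positivity)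
    rw [half_eq, Real.sqrt_mul Real.pi_pos.le, Real.sqrt_sq hy.le] at h
    simp only
    linarith
  have ha : 0 < √μ := Real.sqrt_pos.2 hμ
  have h1 := g_integrable hc hX (√μ) ha
  have h2 := g_integral hc hX (√μ) ha
  simp only [hc2] at h1 h2
  refine ⟨h1, ?_⟩
  rw [h2, threeHalf_eq, Real.sq_sqrt hμ.le, Real.sqrt_mul Real.pi_pos.le]
  have hp : 0 < √π := by positivity
  have e : √μ ^ 3 = μ * √μ := by rw [pow_succ, Real.sq_sqrt hμ.le]
  rw [e]
  generalize BB (xstar μ) = b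
  field_simp
  ring
end
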